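/- Let n be a positive integer that is not a perfect square and let Q = [a,b,c] be an integral binary quadratic form of discriminant 4n and content k, so that d' := 4n/k² is the discriminant of the primitive form Q/k (a positive nonsquare discriminant). Then, as T → ∞, F_T^Q = 6·T·log(λ_{d'})/(π²·n^{1/2}) + o(T). -/

import Mathlib

open Filter Real Asymptotics

/-- The substitution action of `SL₂(ℤ)` on integral binary quadratic forms, where a form
`a x² + b x y + c y²` is encoded as the triple `(a, b, c)`: for `g = (p q; r s)` the form
`g • Q` is `(x, y) ↦ Q (p x + q y, r x + s y)`. -/
def actForm (g : Matrix.SpecialLinearGroup (Fin 2) ℤ) (Q : ℤ × ℤ × ℤ) : ℤ × ℤ × ℤ :=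
  let p := (g : Matrix (Fin 2) (Fin 2) ℤ) 0 0
  let q := (g : Matrix (Fin 2) (Fin 2) ℤ) 0 1
  let r := (g : Matrix (Fin 2) (Fin 2) ℤ) 1 0
  let s := (g : Matrix (Fin 2) (Fin 2) ℤ) 1 1
  (Q.1 * p ^ 2 + Q.2.1 * p * r + Q.2.2 * r ^ 2,
   2 * Q.1 * p * q + Q.2.1 * (p * s + q * r) + 2 * Q.2.2 * r * s,
   Q.1 * q ^ 2 + Q.2.1 * q * s + Q.2.2 * s ^ 2)

/-- Proper (`SL₂(ℤ)`) equivalence of integral binary quadratic forms. -/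
def ProperEquiv (Q Q' : ℤ × ℤ × ℤ) : Prop := ∃ g, actForm g Q = Q'

/-- `DTQ n Q T` is the number of `D(n)`-pairs `{a, c}` (written with `a > c`) with
`a, c ∈ {-T, …, T}` whose associated form `E_{ac} = [a, 2√(ac+n), c]` is properly
equivalent to `Q`. -/
noncomputable def DTQ (n : ℤ) (Q : ℤ × ℤ × ℤ) (T : ℝ) : ℕ :=
  Set.ncard {ac : ℤ × ℤ | ac.2 < ac.1 ∧ ac.1 ≠ 0 ∧ ac.2 ≠ 0 ∧
    |(ac.1 : ℝ)| ≤ T ∧ |(ac.2 : ℝ)| ≤ T ∧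
    ∃ b : ℤ, 0 ≤ b ∧ b ^ 2 = ac.1 * ac.2 + n ∧ ProperEquiv (ac.1, 2 * b, ac.2) Q}

/-- `FTQ Q T` is the number of integral binary quadratic forms `[a, b, c]` with
`|a| ≤ T`, `|c| ≤ T`, `a > c`, `b ≥ 0` which are properly equivalent to `Q`. -/
noncomputable def FTQ (Q : ℤ × ℤ × ℤ) (T : ℝ) : ℕ :=
  Set.ncard {f : ℤ × ℤ × ℤ | |(f.1 : ℝ)| ≤ T ∧ |(f.2.2 : ℝ)| ≤ T ∧
    f.2.2 < f.1 ∧ 0 ≤ f.2.1 ∧ ProperEquiv f Q}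

/-- `ω(d)`: the number of `SL₂(ℤ)`-automorphs of a primitive definite form of
discriminant `d`. -/
def omegaDisc (d : ℤ) : ℕ := if d = -4 then 4 else if d = -3 then 6 else 2


open MeasureTheory Topology
open scoped Pointwise

theorem hasSum_moebius_div_sq :
    HasSum (fun d : ℕ => (ArithmeticFunction.moebius d : ℝ) / (d : ℝ) ^ 2) (6 / π ^ 2) := by
  have h2 : (1 : ℝ) < (2 : ℂ).re := by norm_num
  have hs := (ArithmeticFunction.LSeriesSummable_moebius_iff (s := 2)).2 h2
  have hv := ArithmeticFunction.LSeries_zeta_mul_Lseries_moebius h2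
  rw [ArithmeticFunction.LSeries_zeta_eq_riemannZeta h2, riemannZeta_two] at hv
  have hH := Summable.hasSum hs
  have hval : LSeries (fun n => ((ArithmeticFunction.moebius n : ℤ) : ℂ)) 2
      = ((6 / π ^ 2 : ℝ) : ℂ) := by
    have hpi : (π : ℂ) ≠ 0 := by exact_mod_cast Real.pi_ne_zero
    push_cast
    field_simp
    field_simp at hv
    linear_combination hv
  rw [← LSeries, hval] at hH
  rw [← Complex.hasSum_ofReal]
  refine hH.congr_fun ?_
  intro d
  rcases eq_or_ne d 0 with rfl | hd
  · simp
  · rw [LSeries.term_of_ne_zero hd]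
    push_cast
    norm_cast

/-- Integer points of the dilate `R • S`. -/
def dilatePts (S : Set (Fin 2 → ℝ)) (R : ℝ) : Set (ℤ × ℤ) :=
  {v | ![(v.1 : ℝ) / R, (v.2 : ℝ) / R] ∈ S}

theorem dilatePts_subset {S : Set (Fin 2 → ℝ)} {B : ℝ} (hB : ∀ x ∈ S, ‖x‖ ≤ B) {R : ℝ}
    (hR : 0 < R) :
    dilatePts S R ⊆ (Finset.Icc (-⌊B * R⌋) ⌊B * R⌋ ×ˢ Finset.Icc (-⌊B * R⌋) ⌊B * R⌋ :
      Finset (ℤ × ℤ)) := by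
  intro v hv
  have h := hB _ hv
  rw [pi_norm_le_iff_of_nonneg ((norm_nonneg _).trans h)] at h
  have key : ∀ m : ℤ, ‖(m : ℝ) / R‖ ≤ B → -⌊B * R⌋ ≤ m ∧ m ≤ ⌊B * R⌋ := by
    intro m hm
    rw [Real.norm_eq_abs, abs_div, abs_of_pos hR, div_le_iff₀ hR, abs_le] at hm
    constructor
    · rw [neg_le, Int.le_floor]; push_cast; linarith
    · rw [Int.le_floor]; exact hm.2
  simp only [Finset.coe_product, Set.mem_prod, Finset.coe_Icc, Set.mem_Icc]
  exact ⟨key _ (h 0), key _ (h 1)⟩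

theorem dilatePts_finite {S : Set (Fin 2 → ℝ)} {B : ℝ} (hB : ∀ x ∈ S, ‖x‖ ≤ B) {R : ℝ}
    (hR : 0 < R) : (dilatePts S R).Finite :=
  (Finset.finite_toSet _).subset (dilatePts_subset hB hR)

theorem ncard_dilatePts_le {S : Set (Fin 2 → ℝ)} {B : ℝ} (hB : ∀ x ∈ S, ‖x‖ ≤ B)
    (h0 : (0 : Fin 2 → ℝ) ∉ S) {R : ℝ} (hR : 0 < R) :
    ((dilatePts S R).ncard : ℝ) ≤ 9 * B ^ 2 * R ^ 2 := by
  rcases (dilatePts S R).eq_empty_or_nonempty with h | ⟨v, hv⟩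
  · rw [h]; simp; positivity
  have hcard := Set.ncard_le_ncard (dilatePts_subset hB hR) (Finset.finite_toSet _)
  rw [Set.ncard_coe_finset, Finset.card_product, Int.card_Icc] at hcard
  have hmem := dilatePts_subset hB hR hv
  simp only [Finset.coe_product, Set.mem_prod, Finset.coe_Icc, Set.mem_Icc] at hmem
  have hK : 1 ≤ ⌊B * R⌋ := by
    by_contra hlt
    have h1 : v.1 = 0 := by omega
    have h2 : v.2 = 0 := by omega
    apply h0
    have : ![(v.1 : ℝ) / R, (v.2 : ℝ) / R] = 0 := by
      ext i; fin_cases i <;> simp [h1, h2]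
    simpa [dilatePts, this] using hv
  set K := ⌊B * R⌋ with hKdef
  have hle : (K : ℝ) ≤ B * R := Int.floor_le _
  have hK' : (1 : ℝ) ≤ K := by exact_mod_cast hK
  have hn : (((K + 1 - -K).toNat : ℕ) : ℝ) = 2 * K + 1 := by
    have : (((K + 1 - -K).toNat : ℕ) : ℤ) = 2 * K + 1 := by omega
    exact_mod_cast this
  calc ((dilatePts S R).ncard : ℝ) ≤ (((K + 1 - -K).toNat * (K + 1 - -K).toNat : ℕ) : ℝ) := by
        exact_mod_cast hcard
    _ = (2 * K + 1) ^ 2 := by push_cast; rw [hn]; ring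
    _ ≤ (3 * (B * R)) ^ 2 := by gcongr; linarith
    _ = _ := by ring

theorem tendsto_ncard_dilatePts {S : Set (Fin 2 → ℝ)} (hb : Bornology.IsBounded S)
    (hm : MeasurableSet S) (hf : volume (frontier S) = 0)
    (hstar : ∀ ⦃x y : ℝ⦄, 0 < x → x ≤ y → x • S ⊆ y • S) :
    Tendsto (fun R : ℝ => ((dilatePts S R).ncard : ℝ) / R ^ 2) atTop (𝓝 (volume.real S)) := by
  have h := tendsto_card_div_pow_atTop_volume' S hb hm hf hstar
  refine h.congr' ?_
  filter_upwards [eventually_gt_atTop 0] with R hR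
  simp only [Fintype.card_fin]
  congr 2
  have : (fun v : ℤ × ℤ => ![(v.1 : ℝ) / R, (v.2 : ℝ) / R]) '' dilatePts S R =
      S ∩ R⁻¹ • (Submodule.span ℤ (Set.range (Pi.basisFun ℝ (Fin 2))) : Set (Fin 2 → ℝ)) := by
    ext x
    simp only [Set.mem_image, dilatePts, Set.mem_ofPred_eq, Set.mem_inter_iff,
      Set.mem_smul_set, SetLike.mem_coe]
    constructor
    · rintro ⟨v, hv, rfl⟩
      refine ⟨hv, ![(v.1 : ℝ), v.2], ?_, ?_⟩
      · rw [(Pi.basisFun ℝ (Fin 2)).mem_span_iff_repr_mem ℤ]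
        intro i; fin_cases i <;> simp
      · ext i; fin_cases i <;> simp [div_eq_inv_mul]
    · rintro ⟨hx, y, hy, rfl⟩
      rw [(Pi.basisFun ℝ (Fin 2)).mem_span_iff_repr_mem ℤ] at hy
      obtain ⟨p, hp⟩ := hy 0
      obtain ⟨q, hq⟩ := hy 1
      simp only [algebraMap_int_eq, eq_intCast, Pi.basisFun_repr] at hp hq
      have e : ![(p : ℝ) / R, (q : ℝ) / R] = R⁻¹ • y := by
        ext i; fin_cases i <;> simp [div_eq_inv_mul, hp, hq]
      exact ⟨(p, q), by simpa [e] using hx, e⟩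
  rw [← this, Nat.card_coe_set_eq, Set.ncard_image_of_injective]
  intro v w hvw
  have h0 := congrFun hvw 0
  have h1 := congrFun hvw 1
  simp only [Matrix.cons_val_zero, Matrix.cons_val_one] at h0 h1
  rw [div_left_inj' hR.ne'] at h0 h1
  exact Prod.ext (by exact_mod_cast h0) (by exact_mod_cast h1)

theorem ncard_dilatePts_dvd (S : Set (Fin 2 → ℝ)) (R : ℝ) {d : ℕ} (hd : d ≠ 0) :
    {v ∈ dilatePts S R | d ∣ Int.gcd v.1 v.2}.ncard = (dilatePts S (R / d)).ncard := by
  have hd' : (d : ℤ) ≠ 0 := by exact_mod_cast hd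
  have hdR : (d : ℝ) ≠ 0 := by exact_mod_cast hd
  have : (fun v : ℤ × ℤ => ((d : ℤ) * v.1, (d : ℤ) * v.2)) '' dilatePts S (R / d) =
      {v ∈ dilatePts S R | d ∣ Int.gcd v.1 v.2} := by
    have e : ∀ p : ℤ, ((d * p : ℤ) : ℝ) / R = (p : ℝ) / (R / d) := by
      intro p; push_cast; field_simp
    ext v
    simp only [Set.mem_image, dilatePts, Set.mem_ofPred_eq]
    constructor
    · rintro ⟨w, hw, rfl⟩
      refine ⟨by rwa [e, e], ?_⟩
      exact Int.dvd_gcd (dvd_mul_right _ _) (dvd_mul_right _ _)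
    · rintro ⟨hv, hdv⟩
      obtain ⟨p, hp⟩ := (Int.natCast_dvd_natCast.2 hdv).trans (Int.gcd_dvd_left (a := v.1) (b := v.2))
      obtain ⟨q, hq⟩ := (Int.natCast_dvd_natCast.2 hdv).trans (Int.gcd_dvd_right (a := v.1) (b := v.2))
      refine ⟨(p, q), ?_, Prod.ext hp.symm hq.symm⟩
      rw [hp, hq, e, e] at hv
      exact hv
  rw [← this, Set.ncard_image_of_injective]
  intro v w hvw
  simp only [Prod.mk.injEq, mul_eq_mul_left_iff, hd', or_false] at hvw
  exact Prod.ext hvw.1 hvw.2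

theorem hasSum_moebius_ncard_dilatePts {S : Set (Fin 2 → ℝ)} {B : ℝ} (hB : ∀ x ∈ S, ‖x‖ ≤ B)
    (h0 : (0 : Fin 2 → ℝ) ∉ S) {R : ℝ} (hR : 0 < R) :
    HasSum (fun d : ℕ => (ArithmeticFunction.moebius d : ℝ) * (dilatePts S (R / d)).ncard)
      ({v ∈ dilatePts S R | IsCoprime v.1 v.2}.ncard : ℝ) := by
  classical
  have hfin := dilatePts_finite hB hR
  have hne : ∀ v ∈ dilatePts S R, Int.gcd v.1 v.2 ≠ 0 := by
    intro v hv hg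
    rw [Int.gcd_eq_zero_iff] at hg
    apply h0
    have : ![(v.1 : ℝ) / R, (v.2 : ℝ) / R] = 0 := by
      ext i; fin_cases i <;> simp [hg.1, hg.2]
    simpa [dilatePts, this] using hv
  set F := hfin.toFinset with hF
  set K := F.sup (fun v => Int.gcd v.1 v.2) with hK
  have hcard : ∀ (P : ℤ × ℤ → Prop) [DecidablePred P], {v ∈ dilatePts S R | P v}.ncard = (F.filter P).card := by
    intro P _
    rw [← Set.ncard_coe_finset]
    congr 1
    ext v; simp [hF]
  have hzero : ∀ d ∉ Finset.range (K + 1),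
      (ArithmeticFunction.moebius d : ℝ) * (dilatePts S (R / d)).ncard = 0 := by
    intro d hd
    rw [Finset.mem_range, not_lt] at hd
    rw [← ncard_dilatePts_dvd S R (by omega : d ≠ 0), hcard, Finset.card_eq_zero.2, Nat.cast_zero,
      mul_zero]
    rw [Finset.filter_eq_empty_iff]
    intro v hv hdv
    have h1 := Nat.le_of_dvd (Nat.pos_of_ne_zero (hne v (by simpa [hF] using hv))) hdv
    have h2 := Finset.le_sup (f := fun v : ℤ × ℤ => Int.gcd v.1 v.2) hv
    simp only [← hK] at h2
    omega
  have hind : ∀ v ∈ F, (if IsCoprime v.1 v.2 then (1 : ℤ) else 0) =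
      ∑ d ∈ Finset.range (K + 1),
        if d ∣ Int.gcd v.1 v.2 then ArithmeticFunction.moebius d else 0 := by
    intro v hv
    have hv0 := hne v (by simpa [hF] using hv)
    have h2 := Finset.le_sup (f := fun v : ℤ × ℤ => Int.gcd v.1 v.2) hv
    simp only [← hK] at h2
    have e : (Finset.range (K + 1)).filter (fun d => d ∣ Int.gcd v.1 v.2) =
        (Int.gcd v.1 v.2).divisors := by
      ext d
      simp only [Finset.mem_filter, Finset.mem_range, Nat.mem_divisors]
      constructor
      · rintro ⟨_, h⟩; exact ⟨h, hv0⟩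
      · rintro ⟨h, _⟩
        have := Nat.le_of_dvd (Nat.pos_of_ne_zero hv0) h
        exact ⟨by omega, h⟩
    rw [← Finset.sum_filter, e, ← ArithmeticFunction.coe_mul_zeta_apply,
      ArithmeticFunction.moebius_mul_coe_zeta, ArithmeticFunction.one_apply]
    simp only [Int.isCoprime_iff_gcd_eq_one]
  have hmain : ((F.filter (fun v => IsCoprime v.1 v.2)).card : ℤ) =
      ∑ d ∈ Finset.range (K + 1), ArithmeticFunction.moebius d * (dilatePts S (R / d)).ncard := by
    rw [Finset.card_filter]
    push_cast
    rw [Finset.sum_congr rfl hind, Finset.sum_comm]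
    refine Finset.sum_congr rfl fun d _ => ?_
    rcases eq_or_ne d 0 with rfl | hd
    · simp
    · rw [← ncard_dilatePts_dvd S R hd, hcard, ← Finset.sum_filter, Finset.sum_const, nsmul_eq_mul,
        mul_comm]
  have hmainR := congrArg (Int.cast : ℤ → ℝ) hmain
  push_cast at hmainR
  rw [hcard, hmainR]
  exact hasSum_sum_of_ne_finset_zero hzero

/-- The number of primitive integer points in the dilates of a star-shaped Jordan region. -/
theorem tendsto_ncard_coprime_dilatePts {S : Set (Fin 2 → ℝ)} (hb : Bornology.IsBounded S)
    (hm : MeasurableSet S) (hf : volume (frontier S) = 0)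
    (hstar : ∀ ⦃x y : ℝ⦄, 0 < x → x ≤ y → x • S ⊆ y • S) (h0 : (0 : Fin 2 → ℝ) ∉ S) :
    Tendsto (fun R : ℝ => ({v ∈ dilatePts S R | IsCoprime v.1 v.2}.ncard : ℝ) / R ^ 2) atTop
      (𝓝 (6 / π ^ 2 * volume.real S)) := by
  obtain ⟨B, hB⟩ := hb.exists_norm_le
  have hlim := tendsto_ncard_dilatePts hb hm hf hstar
  have hsum := (hasSum_moebius_div_sq.mul_right (volume.real S)).tsum_eq
  rw [← hsum]
  have hsq : Summable fun d : ℕ => 9 * B ^ 2 * (1 / (d : ℝ) ^ 2) :=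
    (Real.summable_one_div_nat_pow.2 one_lt_two).mul_left _
  have hT := tendsto_tsum_of_dominated_convergence (𝓕 := atTop)
    (f := fun (R : ℝ) (d : ℕ) =>
      (ArithmeticFunction.moebius d : ℝ) * (dilatePts S (R / d)).ncard / R ^ 2)
    (g := fun d : ℕ => (ArithmeticFunction.moebius d : ℝ) / (d : ℝ) ^ 2 * volume.real S)
    hsq ?_ ?_
  · refine hT.congr' ?_
    filter_upwards [eventually_gt_atTop 0] with R hR
    exact ((hasSum_moebius_ncard_dilatePts hB h0 hR).div_const _).tsum_eq
  · intro d
    rcases eq_or_ne d 0 with rfl | hd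
    · simp
    have hd' : (0 : ℝ) < d := by positivity
    have h1 := (hlim.comp (tendsto_id.atTop_div_const hd')).const_mul
      ((ArithmeticFunction.moebius d : ℝ) / (d : ℝ) ^ 2)
    refine h1.congr fun R => ?_
    simp only [Function.comp, id]
    field_simp
  · filter_upwards [eventually_gt_atTop 0] with R hR d
    rcases eq_or_ne d 0 with rfl | hd
    · simp
    have hd' : (0 : ℝ) < d := by positivity
    have hle := ncard_dilatePts_le hB h0 (div_pos hR hd')
    have hmu : |(ArithmeticFunction.moebius d : ℝ)| ≤ 1 := by
      exact_mod_cast ArithmeticFunction.abs_moebius_le_one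
    rw [Real.norm_eq_abs, abs_div, abs_mul, Nat.abs_cast, abs_of_pos (by positivity : 0 < R ^ 2),
      div_le_iff₀ (by positivity)]
    calc _ ≤ 1 * (9 * B ^ 2 * (R / d) ^ 2) := by gcongr
      _ = _ := by field_simp

/-- A sector of the region under the hyperbola `u v = W`. -/
def hyperbolicSector (l W : ℝ) : Set (ℝ × ℝ) :=
  {p | 0 < p.2 ∧ p.2 ≤ p.1 ∧ p.1 < l ^ 2 * p.2 ∧ p.1 * p.2 ≤ W}

/-- The curves bounding `hyperbolicSector l W`. -/
def hyperbolicSectorWalls (l W : ℝ) : Set (ℝ × ℝ) :=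
  {p | p.2 = p.1 ∨ p.1 = l ^ 2 * p.2 ∨ p.1 * p.2 = W}

theorem measurableSet_hyperbolicSectorWalls (l W : ℝ) :
    MeasurableSet (hyperbolicSectorWalls l W) := by
  unfold hyperbolicSectorWalls
  measurability

theorem volume_hyperbolicSectorWalls {l W : ℝ} (hl : 1 < l) :
    volume (hyperbolicSectorWalls l W) = 0 := by
  have h : (volume : Measure (ℝ × ℝ)) = (volume : Measure ℝ).prod volume := rfl
  rw [h, Measure.measure_prod_null (measurableSet_hyperbolicSectorWalls l W)]
  have hne : ∀ᵐ u : ℝ, u ≠ 0 := by simp [ae_iff]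
  filter_upwards [hne] with u hu
  refine Set.Finite.measure_zero (Set.Finite.subset (s := {u, u / l ^ 2, W / u}) (by simp) ?_) _
  intro v hv
  have hl2 : l ^ 2 ≠ 0 := by positivity
  rcases hv with hv | hv | hv
  · left; exact hv
  · right; left; simp only at hv; rw [hv]; field_simp
  · right; right; simp only at hv; rw [Set.mem_singleton_iff, ← hv]; field_simp

theorem frontier_hyperbolicSector_subset {l W : ℝ} (hl : 1 < l) :
    frontier (hyperbolicSector l W) ⊆ hyperbolicSectorWalls l W := by
  have hcl : closure (hyperbolicSector l W) ⊆ {p | p.2 ≤ p.1 ∧ p.1 ≤ l ^ 2 * p.2 ∧ p.1 * p.2 ≤ W} := by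
    apply closure_minimal
    · rintro p ⟨h0, h1, h2, h3⟩; exact ⟨h1, h2.le, h3⟩
    · have c1 : IsClosed {p : ℝ × ℝ | p.2 ≤ p.1} := isClosed_le (by fun_prop) (by fun_prop)
      have c2 : IsClosed {p : ℝ × ℝ | p.1 ≤ l ^ 2 * p.2} := isClosed_le (by fun_prop) (by fun_prop)
      have c3 : IsClosed {p : ℝ × ℝ | p.1 * p.2 ≤ W} := isClosed_le (by fun_prop) (by fun_prop)
      exact c1.inter (c2.inter c3)
  have hin : {p : ℝ × ℝ | p.2 < p.1 ∧ p.1 < l ^ 2 * p.2 ∧ p.1 * p.2 < W} ⊆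
      interior (hyperbolicSector l W) := by
    apply interior_maximal
    · rintro p ⟨h1, h2, h3⟩
      refine ⟨?_, h1.le, h2, h3.le⟩
      have : 0 < (l ^ 2 - 1) * p.2 := by linarith
      exact pos_of_mul_pos_right this (by nlinarith)
    · have c1 : IsOpen {p : ℝ × ℝ | p.2 < p.1} := isOpen_lt (by fun_prop) (by fun_prop)
      have c2 : IsOpen {p : ℝ × ℝ | p.1 < l ^ 2 * p.2} := isOpen_lt (by fun_prop) (by fun_prop)
      have c3 : IsOpen {p : ℝ × ℝ | p.1 * p.2 < W} := isOpen_lt (by fun_prop) (by fun_prop)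
      exact c1.inter (c2.inter c3)
  rintro p ⟨hp, hp'⟩
  obtain ⟨h1, h2, h3⟩ := hcl hp
  by_contra hw
  simp only [hyperbolicSectorWalls, Set.mem_ofPred_eq, not_or] at hw
  exact hp' (hin ⟨lt_of_le_of_ne h1 hw.1, lt_of_le_of_ne h2 hw.2.1, lt_of_le_of_ne h3 hw.2.2⟩)

theorem measurableSet_hyperbolicSector (l W : ℝ) : MeasurableSet (hyperbolicSector l W) := by
  unfold hyperbolicSector
  measurability

theorem volume_hyperbolicSector {l W : ℝ} (hl : 1 < l) (hW : 0 < W) :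
    volume.real (hyperbolicSector l W) = W * Real.log l := by
  have hl0 : 0 < l := by linarith
  set w := √W with hw
  have hw0 : 0 < w := Real.sqrt_pos.2 hW
  have hww : w * w = W := Real.mul_self_sqrt hW.le
  have hwl : w ≤ w * l := by nlinarith
  set g : ℝ → ℝ := fun u => min u (W / u)
  have hg1 : ∀ u, 0 ≤ u → u ≤ w → g u = u := by
    intro u hu huw
    apply min_eq_left
    rcases hu.eq_or_lt with rfl | hu
    · simp
    · rw [le_div_iff₀ hu]; nlinarith
  have hg2 : ∀ u, w ≤ u → g u = W / u := by
    intro u huw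
    apply min_eq_right
    have hu : 0 < u := hw0.trans_le huw
    rw [div_le_iff₀ hu]; nlinarith
  have hae : hyperbolicSector l W =ᵐ[volume]
      regionBetween (fun u => u / l ^ 2) g (Set.Ioc 0 (w * l)) := by
    have hZ : ∀ᵐ p : ℝ × ℝ, p ∉ hyperbolicSectorWalls l W :=
      measure_eq_zero_iff_ae_notMem.1 (volume_hyperbolicSectorWalls hl)
    rw [Filter.eventuallyEq_set]
    filter_upwards [hZ] with p hp
    simp only [hyperbolicSectorWalls, Set.mem_ofPred_eq, not_or] at hp
    obtain ⟨n1, n2, n3⟩ := hp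
    simp only [hyperbolicSector, regionBetween, Set.mem_ofPred_eq, Set.mem_Ioc, Set.mem_Ioo, g,
      lt_min_iff]
    constructor
    · rintro ⟨h0, h1, h2, h3⟩
      have hp1 : 0 < p.1 := by linarith
      refine ⟨⟨hp1, ?_⟩, ?_, lt_of_le_of_ne h1 n1, ?_⟩
      · refine (sq_le_sq₀ hp1.le (by positivity)).1 ?_
        calc p.1 ^ 2 = p.1 * p.1 := sq _
          _ ≤ p.1 * (l ^ 2 * p.2) := by gcongr
          _ = l ^ 2 * (p.1 * p.2) := by ring
          _ ≤ l ^ 2 * W := by gcongr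
          _ = (w * l) ^ 2 := by rw [← hww]; ring
      · rw [div_lt_iff₀ (by positivity)]; linarith
      · rw [lt_div_iff₀ hp1]; rw [mul_comm]; exact lt_of_le_of_ne h3 n3
    · rintro ⟨⟨h0, h1⟩, h2, h3, h4⟩
      rw [lt_div_iff₀ h0] at h4
      rw [div_lt_iff₀ (by positivity)] at h2
      refine ⟨?_, h3.le, by linarith, by linarith⟩
      exact pos_of_mul_pos_left (h0.trans h2) (by positivity)
  have hI1 : IntervalIntegrable g volume 0 w := by
    refine (intervalIntegral.intervalIntegrable_id).congr ?_
    intro u hu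
    rw [Set.uIoc_of_le hw0.le] at hu
    exact (hg1 u hu.1.le hu.2).symm
  have hcont : ContinuousOn (fun u : ℝ => W * u⁻¹) (Set.uIcc w (w * l)) := by
    rw [Set.uIcc_of_le hwl]
    refine continuousOn_const.mul (continuousOn_inv₀.mono ?_)
    intro u hu
    exact (hw0.trans_le hu.1).ne'
  have hI2 : IntervalIntegrable g volume w (w * l) := by
    refine hcont.intervalIntegrable.congr ?_
    intro u hu
    rw [Set.uIoc_of_le hwl] at hu
    rw [hg2 u hu.1.le, div_eq_mul_inv]
  have hI : IntervalIntegrable g volume 0 (w * l) := hI1.trans hI2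
  have hf : IntervalIntegrable (fun u : ℝ => u / l ^ 2) volume 0 (w * l) :=
    (by fun_prop : Continuous fun u : ℝ => u / l ^ 2).intervalIntegrable _ _
  have h0wl : (0 : ℝ) ≤ w * l := by positivity
  have hle : ∀ u ∈ Set.Ioc 0 (w * l), u / l ^ 2 ≤ g u := by
    intro u hu
    have hu0 := hu.1
    refine le_min ?_ ?_
    · exact div_le_self hu0.le (by nlinarith)
    · rw [div_le_div_iff₀ (by positivity) hu0, ← hww]
      nlinarith [hu.2]
  rw [measureReal_def, measure_congr hae, Measure.volume_eq_prod,
    volume_regionBetween_eq_integral (hf.1) (hI.1) measurableSet_Ioc,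
    ENNReal.toReal_ofReal, ← intervalIntegral.integral_of_le h0wl]
  · have hs : ∫ u in (0 : ℝ)..(w * l), (g - fun u : ℝ => u / l ^ 2 : ℝ → ℝ) u =
        (∫ u in (0 : ℝ)..(w * l), g u) - ∫ u in (0 : ℝ)..(w * l), u / l ^ 2 :=
      intervalIntegral.integral_sub hI hf
    rw [hs, ← intervalIntegral.integral_add_adjacent_intervals hI1 hI2]
    have e1 : ∫ u in (0 : ℝ)..w, g u = ∫ u in (0 : ℝ)..w, u := by
      apply intervalIntegral.integral_congr
      intro u hu
      rw [Set.uIcc_of_le hw0.le] at hu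
      exact hg1 u hu.1 hu.2
    have e2 : ∫ u in w..(w * l), g u = ∫ u in w..(w * l), W * u⁻¹ := by
      apply intervalIntegral.integral_congr
      intro u hu
      rw [Set.uIcc_of_le hwl] at hu
      simp only [hg2 u hu.1, div_eq_mul_inv]
    rw [e1, e2, intervalIntegral.integral_const_mul, integral_inv_of_pos hw0 (by positivity),
      intervalIntegral.integral_div, integral_id, integral_id, mul_div_cancel_left₀ _ hw0.ne']
    field_simp
    ring
  · exact setIntegral_nonneg measurableSet_Ioc fun u hu => sub_nonneg.2 (hle u hu)
  · exact hle

theorem smul_mem_hyperbolicSector_iff {l W r : ℝ} (hr : 0 < r) (p : ℝ × ℝ) :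
    r • p ∈ hyperbolicSector l W ↔ p ∈ hyperbolicSector l (W / r ^ 2) := by
  simp only [hyperbolicSector, Set.mem_ofPred_eq, Prod.smul_fst, Prod.smul_snd, smul_eq_mul]
  refine and_congr ?_ (and_congr ?_ (and_congr ?_ ?_))
  · exact mul_pos_iff_of_pos_left hr
  · exact mul_le_mul_iff_right₀ hr
  · rw [mul_left_comm]; exact mul_lt_mul_iff_right₀ hr
  · rw [le_div_iff₀ (by positivity)]; ring_nf

theorem hyperbolicSector_mono {l W W' : ℝ} (h : W ≤ W') :
    hyperbolicSector l W ⊆ hyperbolicSector l W' :=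
  fun _ hp => ⟨hp.1, hp.2.1, hp.2.2.1, hp.2.2.2.trans h⟩

theorem isBounded_hyperbolicSector (l W : ℝ) :
    Bornology.IsBounded (hyperbolicSector l W) := by
  rw [isBounded_iff_forall_norm_le]
  refine ⟨√(l ^ 2 * W), fun p hp => ?_⟩
  obtain ⟨h0, h1, h2, h3⟩ := hp
  have hp1 : 0 < p.1 := by linarith
  have hle : p.1 ≤ √(l ^ 2 * W) := by
    refine Real.le_sqrt_of_sq_le ?_
    calc p.1 ^ 2 = p.1 * p.1 := sq _
      _ ≤ p.1 * (l ^ 2 * p.2) := by gcongr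
      _ = l ^ 2 * (p.1 * p.2) := by ring
      _ ≤ l ^ 2 * W := by gcongr
  rw [Prod.norm_def, Real.norm_eq_abs, Real.norm_eq_abs, abs_of_pos hp1, abs_of_pos h0]
  exact max_le hle (h1.trans hle)

/-- The pair of linear forms `α x + β y` and `γ x + δ y`. -/
def linearForms (α β γ δ : ℝ) : (Fin 2 → ℝ) →ₗ[ℝ] ℝ × ℝ where
  toFun p := (α * p 0 + β * p 1, γ * p 0 + δ * p 1)
  map_add' p q := by ext <;> simp <;> ring
  map_smul' r p := by ext <;> simp <;> ring

theorem volume_preimage_linearForms {α β γ δ : ℝ} (hdet : α * δ - β * γ ≠ 0) {E : Set (ℝ × ℝ)}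
    (hE : MeasurableSet E) :
    volume (linearForms α β γ δ ⁻¹' E) =
      ENNReal.ofReal (|(α * δ - β * γ)⁻¹|) * volume E := by
  have hM : LinearMap.det (Matrix.toLin' !![α, β; γ, δ]) = α * δ - β * γ := by
    rw [LinearMap.det_toLin', Matrix.det_fin_two_of]
  have hpre : linearForms α β γ δ ⁻¹' E =
      Matrix.toLin' !![α, β; γ, δ] ⁻¹' ((MeasurableEquiv.finTwoArrow : (Fin 2 → ℝ) ≃ᵐ ℝ × ℝ) ⁻¹' E) := by
    ext p
    simp [linearForms, MeasurableEquiv.finTwoArrow, dotProduct]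
  rw [hpre, Measure.addHaar_preimage_linearMap _ (by rwa [hM]), hM,
    (volume_preserving_finTwoArrow ℝ).measure_preimage hE.nullMeasurableSet]

theorem tendsto_ncard_coprime_hyperbolicSector {α β γ δ l W : ℝ} (hdet : α * δ - β * γ ≠ 0)
    (hl : 1 < l) (hW : 0 < W) :
    Tendsto (fun T : ℝ => ({v : ℤ × ℤ | IsCoprime v.1 v.2 ∧
        (α * v.1 + β * v.2, γ * v.1 + δ * v.2) ∈ hyperbolicSector l (W * T)}.ncard : ℝ) / T) atTop
      (𝓝 (6 / π ^ 2 * (W * Real.log l / |α * δ - β * γ|))) := by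
  set f := linearForms α β γ δ with hf
  set S : Set (Fin 2 → ℝ) := f ⁻¹' hyperbolicSector l W with hS
  have hfc : Continuous f := LinearMap.continuous_of_finiteDimensional f
  have hinj : Function.Injective f := by
    rw [← LinearMap.ker_eq_bot, LinearMap.ker_eq_bot']
    intro p hp
    have h0 : α * p 0 + β * p 1 = 0 := congrArg Prod.fst hp
    have h1 : γ * p 0 + δ * p 1 = 0 := congrArg Prod.snd hp
    have e0 : (α * δ - β * γ) * p 0 = 0 := by linear_combination δ * h0 - β * h1
    have e1 : (α * δ - β * γ) * p 1 = 0 := by linear_combination α * h1 - γ * h0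
    ext i
    fin_cases i
    · simpa [hdet] using e0
    · simpa [hdet] using e1
  have hbd : Bornology.IsBounded S := by
    obtain ⟨K, -, hK⟩ := f.exists_antilipschitzWith (LinearMap.ker_eq_bot.2 hinj)
    exact hK.isBounded_preimage (isBounded_hyperbolicSector l W)
  have hmeas : MeasurableSet S := hfc.measurable (measurableSet_hyperbolicSector l W)
  have hfr : volume (frontier S) = 0 := by
    refine measure_mono_null ((hfc.frontier_preimage_subset _).trans
      (Set.preimage_mono (frontier_hyperbolicSector_subset hl))) ?_
    rw [volume_preimage_linearForms hdet (measurableSet_hyperbolicSectorWalls l W),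
      volume_hyperbolicSectorWalls hl, mul_zero]
  have hvol : volume.real S = W * Real.log l / |α * δ - β * γ| := by
    rw [measureReal_def, volume_preimage_linearForms hdet (measurableSet_hyperbolicSector l W),
      ENNReal.toReal_mul, ENNReal.toReal_ofReal (abs_nonneg _), ← measureReal_def,
      volume_hyperbolicSector hl hW, abs_inv]
    ring
  have hstar : ∀ ⦃x y : ℝ⦄, 0 < x → x ≤ y → x • S ⊆ y • S := by
    intro x y hx hxy p hp
    have hy : 0 < y := hx.trans_le hxy
    rw [Set.mem_smul_set_iff_inv_smul_mem₀ hx.ne', hS, Set.mem_preimage, map_smul,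
      smul_mem_hyperbolicSector_iff (by positivity)] at hp
    rw [Set.mem_smul_set_iff_inv_smul_mem₀ hy.ne', hS, Set.mem_preimage, map_smul,
      smul_mem_hyperbolicSector_iff (by positivity)]
    exact hyperbolicSector_mono (by gcongr) hp
  have h0 : (0 : Fin 2 → ℝ) ∉ S := by
    intro h
    have := h.1
    simp at this
  have hlim := (tendsto_ncard_coprime_dilatePts hbd hmeas hfr hstar h0).comp
    Real.tendsto_sqrt_atTop
  rw [hvol] at hlim
  refine hlim.congr' ?_
  filter_upwards [eventually_gt_atTop 0] with T hT
  have hs : 0 < √T := Real.sqrt_pos.2 hT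
  simp only [Function.comp, Real.sq_sqrt hT.le]
  congr 3
  ext v
  have e : ![(v.1 : ℝ) / √T, (v.2 : ℝ) / √T] = (√T)⁻¹ • ![(v.1 : ℝ), (v.2 : ℝ)] := by
    ext i; fin_cases i <;> simp [div_eq_inv_mul]
  have e2 : f ![(v.1 : ℝ), (v.2 : ℝ)] = (α * v.1 + β * v.2, γ * v.1 + δ * v.2) := by
    simp [hf, linearForms]
  simp only [Set.mem_ofPred_eq, dilatePts]
  rw [e, hS, Set.mem_preimage, map_smul, e2, smul_mem_hyperbolicSector_iff (by positivity),
    inv_pow, Real.sq_sqrt hT.le, div_inv_eq_mul, and_comm]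

theorem actForm_mul (g h : Matrix.SpecialLinearGroup (Fin 2) ℤ) (Q : ℤ × ℤ × ℤ) :
    actForm (g * h) Q = actForm h (actForm g Q) := by
  simp only [actForm, Matrix.SpecialLinearGroup.coe_mul, Matrix.mul_apply, Fin.sum_univ_two,
    Prod.mk.injEq]
  refine ⟨?_, ?_, ?_⟩ <;> ring

theorem actForm_one (Q : ℤ × ℤ × ℤ) : actForm 1 Q = Q := by
  simp [actForm]

theorem properEquiv_iff_exists_actForm_eq {f Q : ℤ × ℤ × ℤ} :
    ProperEquiv f Q ↔ ∃ g, actForm g Q = f := by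
  constructor
  · rintro ⟨g, rfl⟩
    exact ⟨g⁻¹, by rw [← actForm_mul, mul_inv_cancel, actForm_one]⟩
  · rintro ⟨g, rfl⟩
    exact ⟨g⁻¹, by rw [← actForm_mul, mul_inv_cancel, actForm_one]⟩

/-- The discriminant of a binary quadratic form. -/
def formDisc (Q : ℤ × ℤ × ℤ) : ℤ := Q.2.1 ^ 2 - 4 * Q.1 * Q.2.2

theorem specialLinearGroup_det_eq (g : Matrix.SpecialLinearGroup (Fin 2) ℤ) :
    g.1 0 0 * g.1 1 1 - g.1 0 1 * g.1 1 0 = 1 := by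
  rw [← Matrix.det_fin_two, g.2]

theorem formDisc_actForm (g : Matrix.SpecialLinearGroup (Fin 2) ℤ) (Q : ℤ × ℤ × ℤ) :
    formDisc (actForm g Q) = formDisc Q := by
  have h := specialLinearGroup_det_eq g
  simp only [formDisc, actForm]
  linear_combination (Q.2.1 ^ 2 - 4 * Q.1 * Q.2.2) *
    (g.1 0 0 * g.1 1 1 - g.1 0 1 * g.1 1 0 + 1) * h

theorem ProperEquiv.formDisc_eq {f Q : ℤ × ℤ × ℤ} (h : ProperEquiv f Q) :
    formDisc f = formDisc Q := by
  obtain ⟨g, rfl⟩ := h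
  exact (formDisc_actForm g f).symm

/-- The automorph of `[a, b, c]` attached to a solution of `t² - d s² = 4`. -/
theorem exists_automorph {a b c d t s : ℤ} (hd : b ^ 2 - 4 * a * c = d)
    (hts : t ^ 2 - d * s ^ 2 = 4) :
    ∃ h : Matrix.SpecialLinearGroup (Fin 2) ℤ, actForm h (a, b, c) = (a, b, c) ∧
      2 * h.1 0 0 = t - s * b ∧ h.1 0 1 = -(c * s) ∧ h.1 1 0 = a * s ∧
      2 * h.1 1 1 = t + s * b := by
  obtain ⟨m, hm⟩ : ∃ m, t - s * b = 2 * m := by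
    have h1 : Even ((t - s * b) * (t + s * b)) := by
      refine ⟨2 - 2 * a * c * s ^ 2, ?_⟩
      linear_combination hts - s ^ 2 * hd
    rcases Int.even_mul.1 h1 with h | h
    · obtain ⟨m, hm⟩ := h; exact ⟨m, by linarith⟩
    · obtain ⟨m, hm⟩ := h; exact ⟨m - s * b, by linarith⟩
  have ht : t = 2 * m + s * b := by linarith
  subst ht
  have hdet : m * (m + s * b) - -(c * s) * (a * s) = 1 := by
    have : 4 * (m * (m + s * b) - -(c * s) * (a * s)) = 4 * 1 := by
      linear_combination hts - s ^ 2 * hd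
    linarith
  refine ⟨⟨!![m, -(c * s); a * s, m + s * b], by rw [Matrix.det_fin_two_of]; exact hdet⟩, ?_, ?_⟩
  · simp only [actForm, Matrix.of_apply, Matrix.cons_val_zero, Matrix.cons_val_one,
      Matrix.cons_val', Matrix.cons_val_fin_one, Prod.mk.injEq]
    refine ⟨?_, ?_, ?_⟩
    · linear_combination a * hdet
    · linear_combination b * hdet
    · linear_combination c * hdet
  · simp; ring

/-- Every automorph of a primitive form comes from a solution of `t² - d s² = 4`. -/
theorem exists_pell_of_automorph {a b c d : ℤ} (hd : b ^ 2 - 4 * a * c = d)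
    (hprim : Int.gcd a (Int.gcd b c) = 1) {h : Matrix.SpecialLinearGroup (Fin 2) ℤ}
    (hh : actForm h (a, b, c) = (a, b, c)) :
    ∃ t s : ℤ, t ^ 2 - d * s ^ 2 = 4 ∧
      2 * h.1 0 0 = t - s * b ∧ h.1 0 1 = -(c * s) ∧ h.1 1 0 = a * s ∧
      2 * h.1 1 1 = t + s * b := by
  have hdet := specialLinearGroup_det_eq h
  simp only [actForm, Prod.mk.injEq] at hh
  set p := h.1 0 0
  set q := h.1 0 1
  set r := h.1 1 0
  set s := h.1 1 1
  obtain ⟨h1, h2, h3⟩ := hh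
  have e1 : 2 * (a * (s - p)) = 2 * (b * r) := by
    linear_combination -2 * s * h1 + r * h2 + (2 * a * p + b * r) * hdet
  have e2 : 2 * (a * q) = 2 * -(c * r) := by
    linear_combination s * h2 - 2 * r * h3 - (2 * a * q + b * s) * hdet
  have e3 : 2 * (c * (s - p)) = 2 * -(b * q) := by
    linear_combination -q * h2 + 2 * p * h3 - (b * q + 2 * c * s) * hdet
  replace e1 := mul_left_cancel₀ two_ne_zero e1
  replace e2 := mul_left_cancel₀ two_ne_zero e2
  replace e3 := mul_left_cancel₀ two_ne_zero e3
  obtain ⟨x, y, z, hxyz⟩ : ∃ x y z : ℤ, a * x + b * y + c * z = 1 := by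
    refine ⟨Int.gcdA a (Int.gcd b c), Int.gcdB a (Int.gcd b c) * Int.gcdA b c,
      Int.gcdB a (Int.gcd b c) * Int.gcdB b c, ?_⟩
    have g1 := Int.gcd_eq_gcd_ab a (Int.gcd b c)
    have g2 := Int.gcd_eq_gcd_ab b c
    rw [hprim] at g1
    push_cast at g1
    linear_combination -g1 - Int.gcdB a (Int.gcd b c) * g2
  have f1 : r = a * (x * r + y * (s - p) - z * q) := by
    linear_combination (-r) * hxyz - y * e1 + z * e2
  have f2 : s - p = b * (x * r + y * (s - p) - z * q) := by
    linear_combination (-(s - p)) * hxyz + x * e1 + z * e3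
  have f3 : -q = c * (x * r + y * (s - p) - z * q) := by
    linear_combination q * hxyz - x * e2 - y * e3
  set σ := x * r + y * (s - p) - z * q
  refine ⟨p + s, σ, ?_, ?_, ?_, ?_, ?_⟩
  · rw [← hd]
    linear_combination 4 * hdet + (b * σ + (s - p)) * f2 + 4 * q * f1 - 4 * a * σ * f3
  · linear_combination -f2
  · linear_combination -f3
  · exact f1
  · linear_combination f2

/-- `IsColumn Q v f`: the form `f` is `Q ∘ g` for some `g ∈ SL₂(ℤ)` with first column `v`. -/
def IsColumn (Q : ℤ × ℤ × ℤ) (v : ℤ × ℤ) (f : ℤ × ℤ × ℤ) : Prop :=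
  ∃ g : Matrix.SpecialLinearGroup (Fin 2) ℤ, actForm g Q = f ∧ g.1 0 0 = v.1 ∧ g.1 1 0 = v.2

/-- The value of a binary quadratic form. -/
def formEval (Q : ℤ × ℤ × ℤ) (v : ℤ × ℤ) : ℤ :=
  Q.1 * v.1 ^ 2 + Q.2.1 * v.1 * v.2 + Q.2.2 * v.2 ^ 2

theorem IsColumn.fst_eq {Q f : ℤ × ℤ × ℤ} {v : ℤ × ℤ} (h : IsColumn Q v f) :
    f.1 = formEval Q v := by
  obtain ⟨g, rfl, h1, h2⟩ := h
  simp only [actForm, formEval, h1, h2]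

theorem IsColumn.isCoprime {Q f : ℤ × ℤ × ℤ} {v : ℤ × ℤ} (h : IsColumn Q v f) :
    IsCoprime v.1 v.2 := by
  obtain ⟨g, -, h1, h2⟩ := h
  have := specialLinearGroup_det_eq g
  exact ⟨g.1 1 1, -g.1 0 1, by rw [← h1, ← h2]; linear_combination this⟩

theorem IsColumn.properEquiv {Q f : ℤ × ℤ × ℤ} {v : ℤ × ℤ} (h : IsColumn Q v f) :
    ProperEquiv f Q := by
  obtain ⟨g, hg, -⟩ := h
  exact properEquiv_iff_exists_actForm_eq.2 ⟨g, hg⟩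

theorem exists_isColumn_of_properEquiv {Q f : ℤ × ℤ × ℤ} (h : ProperEquiv f Q) :
    ∃ v, IsColumn Q v f := by
  obtain ⟨g, hg⟩ := properEquiv_iff_exists_actForm_eq.1 h
  exact ⟨(g.1 0 0, g.1 1 0), g, hg, rfl, rfl⟩

theorem exists_reduced_isColumn {Q : ℤ × ℤ × ℤ} {v : ℤ × ℤ} (hv : IsCoprime v.1 v.2)
    (hpos : 0 < formEval Q v) :
    ∃ f, IsColumn Q v f ∧ 0 ≤ f.2.1 ∧ f.2.1 < 2 * f.1 := by
  obtain ⟨x, y, hxy⟩ := hv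
  set A := formEval Q v with hA
  set B := 2 * Q.1 * v.1 * (-y) + Q.2.1 * (v.1 * x + (-y) * v.2) + 2 * Q.2.2 * v.2 * x with hB
  set m := -(B / (2 * A)) with hm
  have hdet : Matrix.det !![v.1, -y + m * v.1; v.2, x + m * v.2] = 1 := by
    rw [Matrix.det_fin_two_of]; linear_combination hxy
  refine ⟨_, ⟨⟨_, hdet⟩, rfl, by simp, by simp⟩, ?_⟩
  have e1 : (actForm ⟨_, hdet⟩ Q).1 = A := by
    simp [actForm, hA, formEval]
  have e2 : (actForm ⟨_, hdet⟩ Q).2.1 = B % (2 * A) := by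
    rw [Int.emod_def]
    simp only [actForm, Matrix.of_apply, Matrix.cons_val_zero, Matrix.cons_val_one,
      Matrix.cons_val', Matrix.cons_val_fin_one]
    have : B - 2 * A * (B / (2 * A)) = B + 2 * A * m := by rw [hm]; ring
    rw [this, hB, hA, formEval]
    ring
  rw [e1, e2]
  exact ⟨Int.emod_nonneg _ (by omega), Int.emod_lt_of_pos _ (by omega)⟩

theorem IsColumn.eq_of_reduced {Q f f' : ℤ × ℤ × ℤ} {v : ℤ × ℤ} (h : IsColumn Q v f)
    (h' : IsColumn Q v f') (hpos : 0 < f.1) (hf0 : 0 ≤ f.2.1) (hf1 : f.2.1 < 2 * f.1)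
    (hf0' : 0 ≤ f'.2.1) (hf1' : f'.2.1 < 2 * f'.1) : f = f' := by
  have ha : f.1 = f'.1 := h.fst_eq.trans h'.fst_eq.symm
  obtain ⟨g, rfl, h1, h2⟩ := h
  obtain ⟨g', rfl, h1', h2'⟩ := h'
  have hd := specialLinearGroup_det_eq g
  have hd' := specialLinearGroup_det_eq g'
  set A := (actForm g Q).1 with hA
  have hcol0 : g'.1 0 0 = g.1 0 0 := h1'.trans h1.symm
  have hcol1 : g'.1 1 0 = g.1 1 0 := h2'.trans h2.symm
  rw [hcol0, hcol1] at hd'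
  set m := g.1 1 1 * (g'.1 0 1 - g.1 0 1) - g.1 0 1 * (g'.1 1 1 - g.1 1 1) with hm
  have k0 : g'.1 0 1 = g.1 0 1 + m * g.1 0 0 := by
    rw [hm]; linear_combination g.1 0 1 * (hd' - hd) - (g'.1 0 1 - g.1 0 1) * hd
  have k1 : g'.1 1 1 = g.1 1 1 + m * g.1 1 0 := by
    rw [hm]; linear_combination g.1 1 1 * (hd' - hd) - (g'.1 1 1 - g.1 1 1) * hd
  have hB : (actForm g' Q).2.1 = (actForm g Q).2.1 + 2 * A * m := by
    rw [hA]
    simp only [actForm, k0, k1, hcol0, hcol1]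
    ring
  rw [← ha] at hf1'
  have hm0 : m = 0 := by
    rw [hB] at hf0' hf1'
    have l1 : m < 1 := by nlinarith
    have l2 : -1 < m := by nlinarith
    omega
  rw [hm0, zero_mul, add_zero] at k0 k1
  simp only [actForm, k0, k1, hcol0, hcol1]

/-- The conjugate linear factors of `4 a Q`, the second one normalised so that their product is
`4 |a| Q`. -/
noncomputable def linearFactors (a b d : ℤ) (v : ℤ × ℤ) : ℝ × ℝ :=
  (2 * a * v.1 + (b + √(d : ℝ)) * v.2, a.sign * (2 * a) * v.1 + a.sign * (b - √(d : ℝ)) * v.2)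

theorem linearFactors_fst_mul_snd {a b c d : ℤ} (hd : b ^ 2 - 4 * a * c = d) (hd0 : 0 ≤ d)
    (v : ℤ × ℤ) :
    (linearFactors a b d v).1 * (linearFactors a b d v).2 =
      4 * |(a : ℝ)| * formEval (a, b, c) v := by
  have hs : (a : ℝ) * a.sign = |(a : ℝ)| := by exact_mod_cast Int.mul_sign_self a
  have he : √(d : ℝ) ^ 2 = d := Real.sq_sqrt (by exact_mod_cast hd0)
  have hdR : (b : ℝ) ^ 2 - 4 * a * c = d := by exact_mod_cast hd
  rw [← hs]
  simp only [linearFactors, formEval]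
  push_cast
  linear_combination (a.sign : ℝ) * (v.2 : ℝ) ^ 2 * (hdR - he)

theorem linear_factor_automorph {a b c d t s : ℤ} (hd : b ^ 2 - 4 * a * c = d) {e : ℝ}
    (he : e ^ 2 = d) {h : Matrix.SpecialLinearGroup (Fin 2) ℤ}
    (h00 : 2 * h.1 0 0 = t - s * b) (h01 : h.1 0 1 = -(c * s)) (h10 : h.1 1 0 = a * s)
    (h11 : 2 * h.1 1 1 = t + s * b) (x y : ℝ) :
    2 * a * (h.1 0 0 * x + h.1 0 1 * y) + (b + e) * (h.1 1 0 * x + h.1 1 1 * y) =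
      (t + s * e) / 2 * (2 * a * x + (b + e) * y) := by
  have hdR : (b : ℝ) ^ 2 - 4 * a * c = d := by exact_mod_cast hd
  have r00 : 2 * (h.1 0 0 : ℝ) = t - s * b := by exact_mod_cast h00
  have r01 : (h.1 0 1 : ℝ) = -(c * s) := by exact_mod_cast h01
  have r10 : (h.1 1 0 : ℝ) = a * s := by exact_mod_cast h10
  have r11 : 2 * (h.1 1 1 : ℝ) = t + s * b := by exact_mod_cast h11
  linear_combination a * x * r00 + 2 * a * y * r01 + (b + e) * x * r10 + (b + e) / 2 * y * r11
    + s * y / 2 * (hdR - he)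

theorem linearFactors_automorph {a b c d t s : ℤ} (hd : b ^ 2 - 4 * a * c = d) (hd0 : 0 ≤ d)
    {h : Matrix.SpecialLinearGroup (Fin 2) ℤ}
    (h00 : 2 * h.1 0 0 = t - s * b) (h01 : h.1 0 1 = -(c * s)) (h10 : h.1 1 0 = a * s)
    (h11 : 2 * h.1 1 1 = t + s * b) (v : ℤ × ℤ) :
    linearFactors a b d (h.1 0 0 * v.1 + h.1 0 1 * v.2, h.1 1 0 * v.1 + h.1 1 1 * v.2) =
      ((t + s * √(d : ℝ)) / 2 * (linearFactors a b d v).1,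
        (t - s * √(d : ℝ)) / 2 * (linearFactors a b d v).2) := by
  have he : √(d : ℝ) ^ 2 = d := Real.sq_sqrt (by exact_mod_cast hd0)
  have p1 := linear_factor_automorph hd he h00 h01 h10 h11 v.1 v.2
  have p2 := linear_factor_automorph hd (e := -√(d : ℝ)) (by rw [neg_sq, he]) h00 h01 h10 h11
    v.1 v.2
  simp only [linearFactors, Prod.mk.injEq]
  push_cast
  refine ⟨p1, ?_⟩
  linear_combination (a.sign : ℝ) * p2

theorem IsColumn.exists_automorph_smul {a b c d t s : ℤ} (hd : b ^ 2 - 4 * a * c = d)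
    (hd0 : 0 ≤ d) (hts : t ^ 2 - d * s ^ 2 = 4) {v : ℤ × ℤ} {f : ℤ × ℤ × ℤ}
    (hv : IsColumn (a, b, c) v f) :
    ∃ w, IsColumn (a, b, c) w f ∧ linearFactors a b d w =
      ((t + s * √(d : ℝ)) / 2 * (linearFactors a b d v).1,
        (t - s * √(d : ℝ)) / 2 * (linearFactors a b d v).2) := by
  obtain ⟨h, hQ, h00, h01, h10, h11⟩ := exists_automorph hd hts
  obtain ⟨g, hg, g0, g1⟩ := hv
  refine ⟨_, ⟨h * g, by rw [actForm_mul, hQ, hg], ?_, ?_⟩,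
    linearFactors_automorph hd hd0 h00 h01 h10 h11 v⟩
  · simp [Matrix.mul_apply, Fin.sum_univ_two, g0, g1]
  · simp [Matrix.mul_apply, Fin.sum_univ_two, g0, g1]

theorem pell_mul_conj {d t s : ℤ} (hd0 : 0 ≤ d) (hts : t ^ 2 - d * s ^ 2 = 4) :
    (t + s * √(d : ℝ)) / 2 * ((t - s * √(d : ℝ)) / 2) = 1 := by
  have he : √(d : ℝ) ^ 2 = d := Real.sq_sqrt (by exact_mod_cast hd0)
  have : (t : ℝ) ^ 2 - d * s ^ 2 = 4 := by exact_mod_cast hts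
  linear_combination this / 4 - (s : ℝ) ^ 2 / 4 * he

theorem one_lt_pell_unit {d t s : ℤ} (hd : 0 < d) (hs : 0 < s) (ht : 0 < t)
    (hts : t ^ 2 - d * s ^ 2 = 4) : 1 < (t + s * √(d : ℝ)) / 2 := by
  have h2 : 2 < t := by nlinarith [mul_pos hd (pow_pos hs 2)]
  have h2' : (2 : ℝ) < t := by exact_mod_cast h2
  have : 0 ≤ s * √(d : ℝ) := mul_nonneg (by exact_mod_cast hs.le) (Real.sqrt_nonneg _)
  linarith

theorem pell_unit_le {d t₀ s₀ t s : ℤ} (hd : 0 < d)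
    (hpell : t₀ ^ 2 - d * s₀ ^ 2 = 4) (ht₀ : 0 < t₀)
    (hmin : ∀ t s : ℤ, 0 < t → 0 < s → t ^ 2 - d * s ^ 2 = 4 → t₀ ≤ t)
    (hts : t ^ 2 - d * s ^ 2 = 4) (ht : 0 < t) (hs : 0 < s) :
    (t₀ + s₀ * √(d : ℝ)) / 2 ≤ (t + s * √(d : ℝ)) / 2 := by
  have h1 := hmin t s ht hs hts
  have h2 : s₀ ≤ s := by
    have : d * s₀ ^ 2 ≤ d * s ^ 2 := by nlinarith
    exact (abs_le_of_sq_le_sq' (le_of_mul_le_mul_left this hd) hs.le).2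
  have h1' : (t₀ : ℝ) ≤ t := by exact_mod_cast h1
  have h2' : (s₀ : ℝ) ≤ s := by exact_mod_cast h2
  gcongr

theorem IsColumn.exists_zpow_smul {a b c d t s : ℤ} (hd : b ^ 2 - 4 * a * c = d)
    (hd0 : 0 ≤ d) (hts : t ^ 2 - d * s ^ 2 = 4) {v : ℤ × ℤ} {f : ℤ × ℤ × ℤ}
    (hv : IsColumn (a, b, c) v f) (j : ℤ) :
    ∃ w, IsColumn (a, b, c) w f ∧ linearFactors a b d w =
      (((t + s * √(d : ℝ)) / 2) ^ j * (linearFactors a b d v).1,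
        ((t - s * √(d : ℝ)) / 2) ^ j * (linearFactors a b d v).2) := by
  have hmul := pell_mul_conj hd0 hts
  have hne := left_ne_zero_of_mul_eq_one hmul
  have hne' := right_ne_zero_of_mul_eq_one hmul
  induction j with
  | zero => exact ⟨v, hv, by simp⟩
  | succ n ih =>
    obtain ⟨w, hw, e⟩ := ih
    obtain ⟨w', hw', e'⟩ := hw.exists_automorph_smul hd hd0 hts
    refine ⟨w', hw', ?_⟩
    rw [e', e, zpow_add_one₀ hne, zpow_add_one₀ hne']
    ext <;> simp only <;> ring
  | pred n ih =>
    obtain ⟨w, hw, e⟩ := ih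
    obtain ⟨w', hw', e'⟩ := hw.exists_automorph_smul hd hd0 (t := t) (s := -s)
      (by linear_combination hts)
    refine ⟨w', hw', ?_⟩
    rw [e', e, zpow_sub_one₀ hne, zpow_sub_one₀ hne', inv_eq_of_mul_eq_one_right hmul,
      inv_eq_of_mul_eq_one_left hmul]
    push_cast
    ext <;> simp only <;> ring

theorem IsColumn.exists_mem_hyperbolicSector {a b c d t s : ℤ} (hd : b ^ 2 - 4 * a * c = d)
    (hd0 : 0 < d) (ha : a ≠ 0) (hts : t ^ 2 - d * s ^ 2 = 4) (ht : 0 < t) (hs : 0 < s)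
    {v : ℤ × ℤ} {f : ℤ × ℤ × ℤ} (hv : IsColumn (a, b, c) v f) (hf : 0 < f.1) {T : ℝ}
    (hT : (f.1 : ℝ) ≤ T) :
    ∃ w, IsColumn (a, b, c) w f ∧ linearFactors a b d w ∈
      hyperbolicSector ((t + s * √(d : ℝ)) / 2) (4 * |(a : ℝ)| * T) := by
  have haR : 0 < |(a : ℝ)| := abs_pos.2 (by exact_mod_cast ha)
  have hfR : (0 : ℝ) < f.1 := by exact_mod_cast hf
  have hmul := pell_mul_conj hd0.le hts
  have hl := one_lt_pell_unit hd0 hs ht hts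
  have hinv := inv_eq_of_mul_eq_one_right hmul
  set l := (t + s * √(d : ℝ)) / 2 with hldef
  have hl0 : 0 < l := by linarith
  have hprod : ∀ w, IsColumn (a, b, c) w f →
      (linearFactors a b d w).1 * (linearFactors a b d w).2 = 4 * |(a : ℝ)| * f.1 := by
    intro w hw
    rw [hw.fst_eq, linearFactors_fst_mul_snd hd hd0.le]
  obtain ⟨v', hv', h1, h2⟩ : ∃ v', IsColumn (a, b, c) v' f ∧ 0 < (linearFactors a b d v').1 ∧
      0 < (linearFactors a b d v').2 := by
    have hp := hprod v hv
    have hpos : 0 < (linearFactors a b d v).1 * (linearFactors a b d v).2 := by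
      rw [hp]; positivity
    rcases mul_pos_iff.1 hpos with h | h
    · exact ⟨v, hv, h⟩
    · obtain ⟨w, hw, e⟩ := hv.exists_automorph_smul hd hd0.le (t := -2) (s := 0) (by norm_num)
      refine ⟨w, hw, ?_⟩
      rw [e]
      push_cast
      constructor <;> linarith
  set u := (linearFactors a b d v').1 with hu
  set u' := (linearFactors a b d v').2 with hu'
  obtain ⟨n, hn1, hn2⟩ := exists_mem_Ico_zpow (div_pos h1 h2)
    (one_lt_pow₀ hl two_ne_zero : 1 < l ^ 2)
  obtain ⟨w, hw, e⟩ := hv'.exists_zpow_smul hd hd0.le hts (-n)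
  refine ⟨w, hw, ?_⟩
  have hp := hprod w hw
  rw [e, ← hinv, ← hldef, ← hu, ← hu'] at hp ⊢
  rw [le_div_iff₀ h2] at hn1
  rw [div_lt_iff₀ h2] at hn2
  have hln : 0 < l ^ n := zpow_pos hl0 n
  have e1 : (l ^ 2) ^ n = l ^ n * l ^ n := by rw [sq, mul_zpow]
  rw [zpow_add_one₀ (by positivity), e1] at hn2
  rw [e1] at hn1
  rw [inv_zpow', neg_neg, zpow_neg] at hp ⊢
  refine ⟨by positivity, ?_, ?_, ?_⟩
  · simp only
    rw [inv_mul_eq_div, le_div_iff₀ hln]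
    linarith
  · simp only
    rw [inv_mul_eq_div, div_lt_iff₀ hln]
    linarith
  · rw [hp]
    gcongr

theorem IsColumn.eq_of_mem_hyperbolicSector {a b c d t₀ s₀ : ℤ} (hd : b ^ 2 - 4 * a * c = d)
    (hd0 : 0 < d) (hprim : Int.gcd a (Int.gcd b c) = 1)
    (hpell : t₀ ^ 2 - d * s₀ ^ 2 = 4) (ht₀ : 0 < t₀) (hs₀ : 0 < s₀)
    (hmin : ∀ t s : ℤ, 0 < t → 0 < s → t ^ 2 - d * s ^ 2 = 4 → t₀ ≤ t)
    {v w : ℤ × ℤ} {f : ℤ × ℤ × ℤ} (hv : IsColumn (a, b, c) v f) (hw : IsColumn (a, b, c) w f)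
    {W : ℝ}
    (hvs : linearFactors a b d v ∈ hyperbolicSector ((t₀ + s₀ * √(d : ℝ)) / 2) W)
    (hws : linearFactors a b d w ∈ hyperbolicSector ((t₀ + s₀ * √(d : ℝ)) / 2) W) : v = w := by
  obtain ⟨g, hg, g0, g1⟩ := hv
  obtain ⟨g', hg', g0', g1'⟩ := hw
  have hQ : actForm (g' * g⁻¹) (a, b, c) = (a, b, c) := by
    rw [actForm_mul, hg', ← hg, ← actForm_mul, mul_inv_cancel, actForm_one]
  have hprod : g' = (g' * g⁻¹) * g := by group
  obtain ⟨t, s, hts, h00, h01, h10, h11⟩ := exists_pell_of_automorph hd hprim hQ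
  have hL := linearFactors_automorph hd hd0.le h00 h01 h10 h11 v
  set h := g' * g⁻¹
  have hwv : w = (h.1 0 0 * v.1 + h.1 0 1 * v.2, h.1 1 0 * v.1 + h.1 1 1 * v.2) := by
    rw [← g0, ← g1]
    ext
    · rw [← g0', hprod]; simp [Matrix.mul_apply, Fin.sum_univ_two]
    · rw [← g1', hprod]; simp [Matrix.mul_apply, Fin.sum_univ_two]
  rw [← hwv] at hL
  have hmul := pell_mul_conj hd0.le hts
  have hl := one_lt_pell_unit hd0 hs₀ ht₀ hpell
  set l := (t₀ + s₀ * √(d : ℝ)) / 2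
  set u := linearFactors a b d v
  obtain ⟨a1, a2, a3, -⟩ := hvs
  obtain ⟨b1, b2, b3, -⟩ := hws
  rw [hL] at b1 b2 b3
  simp only at b1 b2 b3
  have hsum : (t + s * √(d : ℝ)) / 2 + (t - s * √(d : ℝ)) / 2 = t := by ring
  have hεbar : 0 < (t - s * √(d : ℝ)) / 2 := pos_of_mul_pos_left b1 a1.le
  have hε : 0 < (t + s * √(d : ℝ)) / 2 := by
    refine pos_of_mul_pos_left ?_ hεbar.le
    rw [hmul]; exact one_pos
  have ht : 0 < t := by
    have : (0 : ℝ) < t := by linarith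
    exact_mod_cast this
  rcases lt_trichotomy s 0 with hs | rfl | hs
  · exfalso
    have hle := pell_unit_le hd0 hpell ht₀ hmin (t := t) (s := -s) (by linear_combination hts) ht
      (by omega)
    rw [show (t + ((-s : ℤ) : ℝ) * √(d : ℝ)) / 2 = (t - s * √(d : ℝ)) / 2 by push_cast; ring]
      at hle
    set ε := (t + s * √(d : ℝ)) / 2
    set ε' := (t - s * √(d : ℝ)) / 2
    have : l ^ 2 * u.2 ≤ u.1 := by
      calc l ^ 2 * u.2 ≤ ε' ^ 2 * u.2 := by gcongr
        _ = ε' * (ε' * u.2) := by ring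
        _ ≤ ε' * (ε * u.1) := by gcongr
        _ = u.1 := by linear_combination u.1 * hmul
    linarith
  · have ht2 : t = 2 := by nlinarith
    subst ht2
    have e00 : h.1 0 0 = 1 := by linarith
    have e11 : h.1 1 1 = 1 := by linarith
    rw [hwv, e00, e11, h01, h10]
    ext <;> simp
  · exfalso
    have hle := pell_unit_le hd0 hpell ht₀ hmin hts ht hs
    set ε := (t + s * √(d : ℝ)) / 2
    set ε' := (t - s * √(d : ℝ)) / 2
    have : l ^ 2 * (ε' * u.2) ≤ ε * u.1 := by
      calc l ^ 2 * (ε' * u.2) ≤ ε ^ 2 * (ε' * u.2) := by gcongr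
        _ = ε * u.2 := by linear_combination ε * u.2 * hmul
        _ ≤ ε * u.1 := by gcongr
    linarith

/-- The forms `[A, B, C] ∼ Q` with `0 < A ≤ T` and `0 ≤ B < 2A`. -/
def reducedForms (Q : ℤ × ℤ × ℤ) (T : ℝ) : Set (ℤ × ℤ × ℤ) :=
  {f | 0 < f.1 ∧ (f.1 : ℝ) ≤ T ∧ 0 ≤ f.2.1 ∧ f.2.1 < 2 * f.1 ∧ ProperEquiv f Q}

theorem ncard_reducedForms {a b c d t₀ s₀ : ℤ} (hd : b ^ 2 - 4 * a * c = d)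
    (hd0 : 0 < d) (ha : a ≠ 0) (hprim : Int.gcd a (Int.gcd b c) = 1)
    (hpell : t₀ ^ 2 - d * s₀ ^ 2 = 4) (ht₀ : 0 < t₀) (hs₀ : 0 < s₀)
    (hmin : ∀ t s : ℤ, 0 < t → 0 < s → t ^ 2 - d * s ^ 2 = 4 → t₀ ≤ t) (T : ℝ) :
    (reducedForms (a, b, c) T).ncard =
      {v : ℤ × ℤ | IsCoprime v.1 v.2 ∧ linearFactors a b d v ∈
        hyperbolicSector ((t₀ + s₀ * √(d : ℝ)) / 2) (4 * |(a : ℝ)| * T)}.ncard := by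
  have haR : 0 < 4 * |(a : ℝ)| := mul_pos four_pos (abs_pos.2 (by exact_mod_cast ha))
  have key : ∀ f ∈ reducedForms (a, b, c) T, ∃ w, IsColumn (a, b, c) w f ∧
      linearFactors a b d w ∈
        hyperbolicSector ((t₀ + s₀ * √(d : ℝ)) / 2) (4 * |(a : ℝ)| * T) := by
    rintro f ⟨h1, h2, h3, h4, h5⟩
    obtain ⟨v, hv⟩ := exists_isColumn_of_properEquiv h5
    exact hv.exists_mem_hyperbolicSector hd hd0 ha hpell ht₀ hs₀ h1 h2
  choose φ hφ using key
  refine Set.ncard_congr φ (fun f hf => ⟨(hφ f hf).1.isCoprime, (hφ f hf).2⟩) ?_ ?_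
  · intro f f' hf hf' e
    have h1 := (hφ f hf).1
    rw [e] at h1
    exact h1.eq_of_reduced (hφ f' hf').1 hf.1 hf.2.2.1 hf.2.2.2.1 hf'.2.2.1 hf'.2.2.2.1
  · rintro v ⟨hv, hvs⟩
    have hprod := linearFactors_fst_mul_snd hd hd0.le v
    have hpos : (0 : ℝ) < formEval (a, b, c) v := by
      have h1 : 0 < (linearFactors a b d v).1 * (linearFactors a b d v).2 :=
        mul_pos (hvs.1.trans_le hvs.2.1) hvs.1
      rw [hprod] at h1
      exact pos_of_mul_pos_right h1 haR.le
    obtain ⟨f, hvf, hf0, hf1⟩ := exists_reduced_isColumn hv (by exact_mod_cast hpos)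
    have hf : f ∈ reducedForms (a, b, c) T := by
      refine ⟨?_, ?_, hf0, hf1, hvf.properEquiv⟩
      · rw [hvf.fst_eq]; exact_mod_cast hpos
      · rw [hvf.fst_eq]
        have := hvs.2.2.2
        rw [hprod] at this
        exact le_of_mul_le_mul_left this haR
    exact ⟨f, hf, (hφ f hf).1.eq_of_mem_hyperbolicSector hd hd0 hprim hpell ht₀ hs₀ hmin hvf
      (hφ f hf).2 hvs⟩

theorem tendsto_ncard_reducedForms {a b c d t₀ s₀ : ℤ} (hd : b ^ 2 - 4 * a * c = d)
    (hd0 : 0 < d) (ha : a ≠ 0) (hprim : Int.gcd a (Int.gcd b c) = 1)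
    (hpell : t₀ ^ 2 - d * s₀ ^ 2 = 4) (ht₀ : 0 < t₀) (hs₀ : 0 < s₀)
    (hmin : ∀ t s : ℤ, 0 < t → 0 < s → t ^ 2 - d * s ^ 2 = 4 → t₀ ≤ t) :
    Tendsto (fun T : ℝ => ((reducedForms (a, b, c) T).ncard : ℝ) / T) atTop
      (𝓝 (6 / π ^ 2 * (Real.log ((t₀ + s₀ * √(d : ℝ)) / 2) / √(d : ℝ)))) := by
  have haR : 0 < |(a : ℝ)| := abs_pos.2 (by exact_mod_cast ha)
  have hsq : 0 < √(d : ℝ) := Real.sqrt_pos.2 (by exact_mod_cast hd0)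
  have hsign : |(a.sign : ℝ)| = 1 := by
    rcases lt_or_gt_of_ne ha with h | h
    · rw [Int.sign_eq_neg_one_of_neg h]; simp
    · rw [Int.sign_eq_one_of_pos h]; simp
  have hdet : 2 * (a : ℝ) * (a.sign * (b - √(d : ℝ))) - (b + √(d : ℝ)) * (a.sign * (2 * a)) =
      -4 * a.sign * a * √(d : ℝ) := by ring
  have habs : |2 * (a : ℝ) * (a.sign * (b - √(d : ℝ))) - (b + √(d : ℝ)) * (a.sign * (2 * a))| =
      4 * |(a : ℝ)| * √(d : ℝ) := by
    rw [hdet, abs_mul, abs_mul, abs_mul, hsign, abs_of_pos hsq]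
    norm_num
  have hne : 2 * (a : ℝ) * (a.sign * (b - √(d : ℝ))) - (b + √(d : ℝ)) * (a.sign * (2 * a)) ≠ 0 := by
    rw [← abs_pos, habs]; positivity
  have h := tendsto_ncard_coprime_hyperbolicSector hne (one_lt_pell_unit hd0 hs₀ ht₀ hpell)
    (mul_pos four_pos haR)
  rw [habs, mul_div_mul_left _ _ (mul_pos four_pos haR).ne'] at h
  refine h.congr fun T => ?_
  rw [ncard_reducedForms hd hd0 ha hprim hpell ht₀ hs₀ hmin]
  rfl

/-- The forms counted by `FTQ Q T`. -/
def countedForms (Q : ℤ × ℤ × ℤ) (T : ℝ) : Set (ℤ × ℤ × ℤ) :=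
  {f | |(f.1 : ℝ)| ≤ T ∧ |(f.2.2 : ℝ)| ≤ T ∧ f.2.2 < f.1 ∧ 0 ≤ f.2.1 ∧ ProperEquiv f Q}

theorem FTQ_eq_ncard (Q : ℤ × ℤ × ℤ) (T : ℝ) : FTQ Q T = (countedForms Q T).ncard := rfl

/-- The forms of discriminant `d` with outer coefficients bounded by `N`. -/
def boundedForms (d N : ℤ) : Set (ℤ × ℤ × ℤ) :=
  {f | |f.1| ≤ N ∧ |f.2.2| ≤ N ∧ formDisc f = d}

theorem boundedForms_finite (d N : ℤ) : (boundedForms d N).Finite := by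
  refine ((Set.finite_Icc (-N) N).prod ((Set.finite_Icc (-(d + 4 * N ^ 2)) (d + 4 * N ^ 2)).prod
    (Set.finite_Icc (-N) N))).subset ?_
  rintro ⟨a, b, c⟩ ⟨h1, h2, h3⟩
  simp only [formDisc] at h1 h2 h3
  have hac : a * c ≤ N ^ 2 := by
    calc a * c ≤ |a * c| := le_abs_self _
      _ = |a| * |c| := abs_mul _ _
      _ ≤ N * N := mul_le_mul h1 h2 (abs_nonneg _) ((abs_nonneg _).trans h1)
      _ = N ^ 2 := (sq N).symm
  have hb : |b| ≤ d + 4 * N ^ 2 := by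
    have : |b| ≤ b ^ 2 := by rw [← sq_abs]; exact Int.le_self_sq _
    linarith
  simp only [Set.mem_prod, Set.mem_Icc]
  exact ⟨abs_le.1 h1, abs_le.1 hb, abs_le.1 h2⟩

/-- The map `[a, b, c] ↦ [-c, b, -a]`. -/
def flipForm (Q : ℤ × ℤ × ℤ) : ℤ × ℤ × ℤ := (-Q.2.2, Q.2.1, -Q.1)

theorem flipForm_flipForm (Q : ℤ × ℤ × ℤ) : flipForm (flipForm Q) = Q := by
  simp [flipForm]

theorem flipForm_injective : Function.Injective flipForm :=
  Function.LeftInverse.injective flipForm_flipForm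

theorem formDisc_flipForm (Q : ℤ × ℤ × ℤ) : formDisc (flipForm Q) = formDisc Q := by
  simp only [formDisc, flipForm]; ring

theorem ProperEquiv.flipForm {f Q : ℤ × ℤ × ℤ} (h : ProperEquiv f Q) :
    ProperEquiv (flipForm f) (flipForm Q) := by
  obtain ⟨g, rfl⟩ := h
  have hdet := specialLinearGroup_det_eq g
  refine ⟨⟨!![g.1 1 1, -g.1 1 0; -g.1 0 1, g.1 0 0], ?_⟩, ?_⟩
  · rw [Matrix.det_fin_two_of]; linear_combination hdet
  · simp only [actForm, _root_.flipForm, Matrix.of_apply, Matrix.cons_val_zero, Matrix.cons_val_one,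
      Matrix.cons_val', Matrix.cons_val_fin_one, Prod.mk.injEq]
    refine ⟨?_, ?_, ?_⟩ <;> ring

theorem flipForm_mem_countedForms {f Q : ℤ × ℤ × ℤ} {T : ℝ} (h : f ∈ countedForms Q T) :
    flipForm f ∈ countedForms (flipForm Q) T := by
  obtain ⟨h1, h2, h3, h4, h5⟩ := h
  refine ⟨?_, ?_, ?_, h4, h5.flipForm⟩
  · simpa [flipForm] using h2
  · simpa [flipForm] using h1
  · simpa [flipForm] using h3

theorem flipForm_mem_boundedForms {f : ℤ × ℤ × ℤ} {d N : ℤ} (h : f ∈ boundedForms d N) :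
    flipForm f ∈ boundedForms d N := by
  obtain ⟨h1, h2, h3⟩ := h
  refine ⟨?_, ?_, by rw [formDisc_flipForm, h3]⟩
  · simpa [flipForm] using h2
  · simpa [flipForm] using h1

theorem mul_ne_zero_of_formDisc {f : ℤ × ℤ × ℤ} {d : ℤ} (hns : ∀ m : ℤ, m ^ 2 ≠ d)
    (hf : formDisc f = d) : f.1 ≠ 0 ∧ f.2.2 ≠ 0 := by
  constructor
  · intro h; apply hns f.2.1; rw [← hf, formDisc, h]; ring
  · intro h; apply hns f.2.1; rw [← hf, formDisc, h]; ring

theorem mem_reducedForms_of_mem_countedForms {f Q : ℤ × ℤ × ℤ} {d : ℤ} (hd : 0 < d)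
    (hns : ∀ m : ℤ, m ^ 2 ≠ d) (hQ : formDisc Q = d) {T : ℝ} (h : f ∈ countedForms Q T)
    (hdf : d < f.1) : f ∈ reducedForms Q T := by
  obtain ⟨h1, h2, h3, h4, h5⟩ := h
  have hf := h5.formDisc_eq.trans hQ
  refine ⟨hd.trans hdf, (le_abs_self _).trans h1, h4, ?_, h5⟩
  have hc := (mul_ne_zero_of_formDisc hns hf).2
  rw [formDisc] at hf
  have hle : f.2.2 ≤ f.1 - 1 := by omega
  nlinarith

theorem reducedForms_snd_lt {f : ℤ × ℤ × ℤ} {d : ℤ} (hd : 0 < d) (hf : formDisc f = d)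
    (h0 : 0 < f.1) (h1 : 0 ≤ f.2.1) (h2 : f.2.1 < 2 * f.1) : -d < f.2.2 ∧ f.2.2 < f.1 := by
  rw [formDisc] at hf
  constructor <;> nlinarith

theorem reducedForms_subset {Q : ℤ × ℤ × ℤ} {d : ℤ} (hd : 0 < d)
    (hns : ∀ m : ℤ, m ^ 2 ≠ d) (hQ : formDisc Q = d) (T : ℝ) :
    reducedForms Q T ⊆ countedForms Q T ∪ boundedForms d d := by
  rintro f ⟨h0, hT, h1, h2, h3⟩
  have hf := h3.formDisc_eq.trans hQ
  obtain ⟨hc1, hc2⟩ := reducedForms_snd_lt hd hf h0 h1 h2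
  rcases le_or_gt f.1 d with h | h
  · right
    exact ⟨abs_le.2 ⟨by omega, h⟩, abs_le.2 ⟨by omega, by omega⟩, hf⟩
  · left
    have hc0 := (mul_ne_zero_of_formDisc hns hf).2
    have hc : 0 < f.2.2 := by
      rw [formDisc] at hf
      by_contra hneg
      have : f.2.2 ≤ -1 := by omega
      nlinarith
    have hcR : (0 : ℝ) < f.2.2 := by exact_mod_cast hc
    have h0R : (0 : ℝ) < f.1 := by exact_mod_cast h0
    have hcaR : (f.2.2 : ℝ) < f.1 := by exact_mod_cast hc2
    refine ⟨?_, ?_, hc2, h1, h3⟩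
    · rwa [abs_of_pos h0R]
    · rw [abs_of_pos hcR]; linarith

theorem countedForms_finite (Q : ℤ × ℤ × ℤ) (T : ℝ) : (countedForms Q T).Finite := by
  refine (boundedForms_finite (formDisc Q) ⌊T⌋).subset ?_
  rintro f ⟨h1, h2, -, -, h5⟩
  refine ⟨?_, ?_, h5.formDisc_eq⟩
  · rw [Int.le_floor]; push_cast; exact h1
  · rw [Int.le_floor]; push_cast; exact h2

theorem abs_FTQ_sub_ncard_reducedForms_le {Q : ℤ × ℤ × ℤ} {d : ℤ} (hd : 0 < d)
    (hns : ∀ m : ℤ, m ^ 2 ≠ d) (hQ : formDisc Q = d) (T : ℝ) :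
    |(FTQ Q T : ℝ) - ((reducedForms Q T).ncard + (reducedForms (flipForm Q) T).ncard)| ≤
      2 * (boundedForms d d).ncard := by
  set X := countedForms Q T with hX
  set K := boundedForms d d with hK
  set M := reducedForms Q T with hM
  set M' := flipForm '' reducedForms (flipForm Q) T with hM'
  have hQ' : formDisc (flipForm Q) = d := (formDisc_flipForm Q).trans hQ
  have hXfin : X.Finite := countedForms_finite Q T
  have hKfin : K.Finite := boundedForms_finite d d
  have hMX : M ⊆ X ∪ K := reducedForms_subset hd hns hQ T
  have hM'X : M' ⊆ X ∪ K := by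
    rintro _ ⟨f, hf, rfl⟩
    rcases reducedForms_subset hd hns hQ' T hf with h | h
    · left
      have := flipForm_mem_countedForms h
      rwa [flipForm_flipForm] at this
    · right; exact flipForm_mem_boundedForms h
  have hXM : X ⊆ M ∪ M' ∪ K := by
    intro f hf
    by_cases h1 : d < f.1
    · exact Or.inl (Or.inl (mem_reducedForms_of_mem_countedForms hd hns hQ hf h1))
    by_cases h2 : d < -f.2.2
    · exact Or.inl (Or.inr ⟨flipForm f, mem_reducedForms_of_mem_countedForms hd hns hQ'
        (flipForm_mem_countedForms hf) h2, flipForm_flipForm f⟩)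
    · obtain ⟨-, -, h3, -, h5⟩ := hf
      exact Or.inr ⟨abs_le.2 ⟨by omega, by omega⟩, abs_le.2 ⟨by omega, by omega⟩,
        h5.formDisc_eq.trans hQ⟩
  have hMM' : M ∩ M' ⊆ K := by
    rintro _ ⟨h, f, hf, rfl⟩
    obtain ⟨p0, -, p1, p2, p3⟩ := h
    obtain ⟨q0, -, q1, q2, q3⟩ := hf
    have hfd := q3.formDisc_eq.trans hQ'
    obtain ⟨r1, -⟩ := reducedForms_snd_lt hd hfd q0 q1 q2
    obtain ⟨r2, -⟩ := reducedForms_snd_lt hd ((formDisc_flipForm f).trans hfd) p0 p1 p2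
    simp only [flipForm] at p0 r2 ⊢
    refine ⟨abs_le.2 ⟨?_, ?_⟩, abs_le.2 ⟨?_, ?_⟩, (formDisc_flipForm f).trans hfd⟩ <;>
      simp only <;> omega
  have hXK := hXfin.union hKfin
  have hMfin : M.Finite := hXK.subset hMX
  have hM'fin : M'.Finite := hXK.subset hM'X
  have hcM' : M'.ncard = (reducedForms (flipForm Q) T).ncard :=
    Set.ncard_image_of_injective _ flipForm_injective
  have c1 : X.ncard ≤ (M ∪ M').ncard + K.ncard :=
    (Set.ncard_le_ncard hXM ((hMfin.union hM'fin).union hKfin)).trans (Set.ncard_union_le _ _)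
  have c2 : (M ∪ M').ncard ≤ X.ncard + K.ncard :=
    (Set.ncard_le_ncard (Set.union_subset hMX hM'X) hXK).trans (Set.ncard_union_le _ _)
  have c3 := Set.ncard_union_add_ncard_inter M M' hMfin hM'fin
  have c4 : (M ∩ M').ncard ≤ K.ncard := Set.ncard_le_ncard hMM' hKfin
  rw [FTQ_eq_ncard, ← hcM', abs_le]
  constructor
  · have : M.ncard + M'.ncard ≤ X.ncard + 2 * K.ncard := by omega
    have : (M.ncard : ℝ) + M'.ncard ≤ X.ncard + 2 * K.ncard := by exact_mod_cast this
    linarith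
  · have : X.ncard ≤ M.ncard + M'.ncard + 2 * K.ncard := by omega
    have : (X.ncard : ℝ) ≤ M.ncard + M'.ncard + 2 * K.ncard := by exact_mod_cast this
    linarith

theorem tendsto_FTQ_div_of_primitive {a b c d t₀ s₀ : ℤ} (hd : b ^ 2 - 4 * a * c = d)
    (hd0 : 0 < d) (hns : ∀ m : ℤ, m ^ 2 ≠ d) (hprim : Int.gcd a (Int.gcd b c) = 1)
    (hpell : t₀ ^ 2 - d * s₀ ^ 2 = 4) (ht₀ : 0 < t₀) (hs₀ : 0 < s₀)
    (hmin : ∀ t s : ℤ, 0 < t → 0 < s → t ^ 2 - d * s ^ 2 = 4 → t₀ ≤ t) :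
    Tendsto (fun T : ℝ => (FTQ (a, b, c) T : ℝ) / T) atTop
      (𝓝 (12 * Real.log ((t₀ + s₀ * √(d : ℝ)) / 2) / (π ^ 2 * √(d : ℝ)))) := by
  obtain ⟨ha, hc⟩ := mul_ne_zero_of_formDisc (f := (a, b, c)) hns hd
  have h1 := tendsto_ncard_reducedForms hd hd0 ha hprim hpell ht₀ hs₀ hmin
  have h2 := tendsto_ncard_reducedForms (a := -c) (b := b) (c := -a) (d := d)
    (by linear_combination hd) hd0 (neg_ne_zero.2 hc)
    (by
      rw [← hprim, Int.neg_gcd, Int.gcd_comm c, Int.gcd_neg, Int.gcd_comm b a, Int.gcd_assoc])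
    hpell ht₀ hs₀ hmin
  have h3 : Tendsto (fun T : ℝ => ((FTQ (a, b, c) T : ℝ) - ((reducedForms (a, b, c) T).ncard +
      (reducedForms (flipForm (a, b, c)) T).ncard)) / T) atTop (𝓝 0) := by
    refine squeeze_zero_norm' (a := fun T : ℝ => 2 * ((boundedForms d d).ncard : ℝ) / T) ?_
      (tendsto_const_nhds.div_atTop tendsto_id)
    filter_upwards [eventually_gt_atTop 0] with T hT
    rw [norm_div, Real.norm_eq_abs, Real.norm_eq_abs, abs_of_pos hT]
    gcongr
    exact abs_FTQ_sub_ncard_reducedForms_le (Q := (a, b, c)) hd0 hns hd T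
  have hpi : π ≠ 0 := Real.pi_ne_zero
  have hsq : √(d : ℝ) ≠ 0 := (Real.sqrt_pos.2 (by exact_mod_cast hd0)).ne'
  have h4 := h3.add (h1.add h2)
  refine (h4.congr fun T => ?_).trans (le_of_eq ?_)
  · simp only [flipForm]
    ring
  · congr 1
    field_simp
    ring

/-- Multiplication of a form by a scalar. -/
def scaleForm (k : ℤ) (Q : ℤ × ℤ × ℤ) : ℤ × ℤ × ℤ := (k * Q.1, k * Q.2.1, k * Q.2.2)

theorem actForm_scaleForm (g : Matrix.SpecialLinearGroup (Fin 2) ℤ) (k : ℤ) (Q : ℤ × ℤ × ℤ) :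
    actForm g (scaleForm k Q) = scaleForm k (actForm g Q) := by
  simp only [actForm, scaleForm, Prod.mk.injEq]
  refine ⟨?_, ?_, ?_⟩ <;> ring

theorem scaleForm_injective {k : ℤ} (hk : k ≠ 0) : Function.Injective (scaleForm k) := by
  rintro ⟨a, b, c⟩ ⟨a', b', c'⟩ h
  simpa [scaleForm, hk] using h

theorem FTQ_scaleForm {k : ℤ} (hk : 0 < k) (Q : ℤ × ℤ × ℤ) (T : ℝ) :
    FTQ (scaleForm k Q) T = FTQ Q (T / k) := by
  have hkR : (0 : ℝ) < k := by exact_mod_cast hk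
  have habs : ∀ x : ℤ, |((k * x : ℤ) : ℝ)| ≤ T ↔ |(x : ℝ)| ≤ T / k := by
    intro x
    push_cast
    rw [abs_mul, abs_of_pos hkR, le_div_iff₀ hkR, mul_comm]
  have hiff : ∀ f, scaleForm k f ∈ countedForms (scaleForm k Q) T ↔
      f ∈ countedForms Q (T / k) := by
    intro f
    have hequiv : ProperEquiv (scaleForm k f) (scaleForm k Q) ↔ ProperEquiv f Q := by
      simp only [ProperEquiv, actForm_scaleForm, (scaleForm_injective hk.ne').eq_iff]
    simp only [countedForms, Set.mem_ofPred_eq, hequiv]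
    refine and_congr (habs _) (and_congr (habs _) (and_congr ?_ (and_congr_left fun _ => ?_)))
    · exact mul_lt_mul_iff_right₀ hk
    · exact mul_nonneg_iff_of_pos_left hk
  rw [FTQ_eq_ncard, FTQ_eq_ncard, ← Set.ncard_image_of_injective (countedForms Q (T / k)) (scaleForm_injective hk.ne')]
  congr 1
  ext f
  constructor
  · intro hf
    obtain ⟨g, hg⟩ := properEquiv_iff_exists_actForm_eq.1 hf.2.2.2.2
    rw [actForm_scaleForm] at hg
    exact ⟨actForm g Q, (hiff _).1 (by rwa [hg]), hg⟩
  · rintro ⟨f, hf, rfl⟩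
    exact (hiff f).2 hf

/-- **Theorem 2 (b).** For a positive nonsquare integer `n` and an integral binary
quadratic form `Q = [a,b,c]` of discriminant `4n` and content `k` (so `d' = 4n/k²` is a
positive nonsquare discriminant), letting `(t₀, s₀)` be the minimal positive solution of
`t² - d' s² = 4` and `λ_{d'} = (t₀ + s₀ √d')/2`, as `T → ∞` one has
`F_T^Q = 6 T log(λ_{d'}) / (π² n^{1/2}) + o(T)`. -/
theorem orbit_count_indefinite_nonsplit (n : ℤ) (hn : 0 < n)
    (hns : ¬∃ m : ℤ, n = m ^ 2) (a b c : ℤ) (k : ℕ) (d' : ℤ)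
    (hdisc : b ^ 2 - 4 * a * c = 4 * n)
    (hcontent : Int.gcd a (Int.gcd b c) = k)
    (hd' : 4 * n = d' * (k : ℤ) ^ 2)
    (t₀ s₀ : ℤ) (ht₀ : 0 < t₀) (hs₀ : 0 < s₀)
    (hpell : t₀ ^ 2 - d' * s₀ ^ 2 = 4)
    (hmin : ∀ t s : ℤ, 0 < t → 0 < s → t ^ 2 - d' * s ^ 2 = 4 → t₀ ≤ t) :
    (fun T : ℝ => (FTQ (a, b, c) T : ℝ) -
        6 * T * Real.log (((t₀ : ℝ) + (s₀ : ℝ) * Real.sqrt (d' : ℝ)) / 2) /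
          (Real.pi ^ 2 * Real.sqrt (n : ℝ)))
      =o[atTop] (fun T : ℝ => T) := by
  have hk0 : k ≠ 0 := by
    rintro rfl
    simp at hd'
    omega
  have hkZ : (0 : ℤ) < k := by exact_mod_cast Nat.pos_of_ne_zero hk0
  have hd0 : 0 < d' := by
    have : 0 < d' * (k : ℤ) ^ 2 := by rw [← hd']; linarith
    exact pos_of_mul_pos_left this (by positivity)
  have hns' : ∀ m : ℤ, m ^ 2 ≠ d' := by
    intro m hm
    apply hns
    have h4 : (m * k) ^ 2 = 4 * n := by rw [hd', ← hm]; ring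
    obtain ⟨r, hr⟩ : (2 : ℤ) ∣ m * k :=
      Int.prime_two.dvd_of_dvd_pow (n := 2) ⟨2 * n, by rw [h4]; ring⟩
    exact ⟨r, by rw [hr] at h4; linarith⟩
  obtain ⟨A, hA⟩ : (k : ℤ) ∣ a := by rw [← hcontent]; exact Int.gcd_dvd_left ..
  have hkbc : (k : ℤ) ∣ (Int.gcd b c : ℤ) := by rw [← hcontent]; exact Int.gcd_dvd_right ..
  obtain ⟨B, hB⟩ : (k : ℤ) ∣ b := hkbc.trans (Int.gcd_dvd_left ..)
  obtain ⟨C, hC⟩ : (k : ℤ) ∣ c := hkbc.trans (Int.gcd_dvd_right ..)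
  subst hA hB hC
  have hprim : Int.gcd A (Int.gcd B C) = 1 := by
    rw [Int.gcd_mul_left, Int.natAbs_natCast, Nat.cast_mul, Int.gcd_mul_left,
      Int.natAbs_natCast] at hcontent
    exact (Nat.mul_eq_left hk0).1 hcontent
  have hdisc' : B ^ 2 - 4 * A * C = d' := by
    have h2 : (k : ℤ) ^ 2 * (B ^ 2 - 4 * A * C) = (k : ℤ) ^ 2 * d' := by
      linear_combination hdisc + hd'
    exact mul_left_cancel₀ (by positivity) h2
  have hkR : (0 : ℝ) < k := by exact_mod_cast hkZ
  have hlim := ((tendsto_FTQ_div_of_primitive hdisc' hd0 hns' hprim hpell ht₀ hs₀ hmin).comp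
    (tendsto_id.atTop_div_const hkR)).div_const (k : ℝ)
  have hsqrt : 2 * √(n : ℝ) = k * √(d' : ℝ) := by
    have hR : (4 : ℝ) * n = d' * k ^ 2 := by exact_mod_cast hd'
    have h1 : √((4 : ℝ) * n) = 2 * √(n : ℝ) := by
      rw [Real.sqrt_mul (by norm_num), show (4 : ℝ) = 2 ^ 2 by norm_num, Real.sqrt_sq (by norm_num)]
    rw [← h1, hR, Real.sqrt_mul' _ (by positivity), Real.sqrt_sq hkR.le, mul_comm]
  have hsn : 0 < √(n : ℝ) := Real.sqrt_pos.2 (by exact_mod_cast hn)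
  have hsd : 0 < √(d' : ℝ) := Real.sqrt_pos.2 (by exact_mod_cast hd0)
  have hval : 12 * Real.log ((t₀ + s₀ * √(d' : ℝ)) / 2) / (π ^ 2 * √(d' : ℝ)) / k =
      6 * Real.log ((t₀ + s₀ * √(d' : ℝ)) / 2) / (π ^ 2 * √(n : ℝ)) := by
    rw [div_div, div_eq_div_iff (by positivity) (by positivity)]
    linear_combination 6 * Real.log ((t₀ + s₀ * √(d' : ℝ)) / 2) * π ^ 2 * hsqrt
  rw [hval] at hlim
  rw [isLittleO_iff_tendsto' ((eventually_gt_atTop 0).mono fun T hT h => absurd h hT.ne')]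
  rw [← sub_self (6 * Real.log ((t₀ + s₀ * √(d' : ℝ)) / 2) / (π ^ 2 * √(n : ℝ)))]
  refine (hlim.sub_const _).congr' ?_
  filter_upwards [eventually_gt_atTop 0] with T hT
  have hF := FTQ_scaleForm hkZ (A, B, C) T
  simp only [scaleForm, Int.cast_natCast] at hF
  simp only [Function.comp, id]
  rw [hF]
  field_simp
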